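/- arXiv:1205.2718 — 2 statements merged into one kernel-verified Lean document; each statement's English description precedes it below -/
import Mathlib

section
/- For every integer q ≥ 3 there exists a constant C > 1 (depending only on q) such that for all integers d ≥ 2 and n ≥ d+1, every real ε with 0 ≤ ε ≤ 1, and every simple n-vertex d-regular graph G whose independence number satisfies α(G) ≥ n(1−ε)/2, the number of proper q-colorings of G satisfies c_q(G) ≤ η(q)^{n/2} · m(q)^{n(1+ε)/(2d)} · C^{n/d²}. -/
/-- The number of proper `q`-colorings of a graph `G`. -/
noncomputable def numColorings {V : Type*} (G : SimpleGraph V) (q : ℕ) : ℕ :=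
  Nat.card {f : V → Fin q // ∀ v w, G.Adj v w → f v ≠ f w}

/-- The independence number of `G`: the largest size of a set of pairwise non-adjacent vertices. -/
noncomputable def indepNum {V : Type*} [Fintype V] (G : SimpleGraph V) : ℕ :=
  sSup {k | ∃ s : Finset V, (∀ v ∈ s, ∀ w ∈ s, ¬ G.Adj v w) ∧ s.card = k}

/-- `η(q) = ⌊q/2⌋ ⌈q/2⌉`, which is `q²/4` for even `q` and `(q²-1)/4` for odd `q`. -/
def eta (q : ℕ) : ℕ := (q / 2) * ((q + 1) / 2)

/-- `m(q)`: `C(q, q/2)` for even `q` and `C(q+1, (q+1)/2)` for odd `q`. -/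
def mq (q : ℕ) : ℕ :=
  if Even q then Nat.choose q (q / 2) else Nat.choose (q + 1) ((q + 1) / 2)

open Finset
open scoped BigOperators

/-- **Hölder's inequality** for finitely many functions and uniform averages. -/
theorem expect_prod_rpow_le {ι κ : Type*} [Fintype κ] (s : Finset ι)
    (w : ι → ℝ) (F : ι → κ → ℝ) (hw : ∀ i ∈ s, 0 ≤ w i) (hw1 : ∑ i ∈ s, w i = 1)
    (hF : ∀ i ∈ s, ∀ c, 0 ≤ F i c) :
    𝔼 c, ∏ i ∈ s, F i c ^ w i ≤ ∏ i ∈ s, (𝔼 c, F i c) ^ w i := by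
  have hm : ∀ i ∈ s, 0 ≤ 𝔼 c, F i c := fun i hi => expect_nonneg fun c _ => hF i hi c
  by_cases hbad : ∃ i ∈ s, w i ≠ 0 ∧ 𝔼 c, F i c = 0
  · obtain ⟨i, hi, hwi, h0⟩ := hbad
    have hz : F i = 0 := (Fintype.expect_eq_zero_iff_of_nonneg (hF i hi)).1 h0
    rw [expect_eq_zero]
    · exact prod_nonneg fun i hi => Real.rpow_nonneg (hm i hi) _
    · intro c _
      exact prod_eq_zero hi (by rw [hz]; exact Real.zero_rpow hwi)
  · push Not at hbad
    have hpt : ∀ c, ∏ i ∈ s, F i c ^ w i ≤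
        (∏ i ∈ s, (𝔼 c, F i c) ^ w i) * ∑ i ∈ s, w i * (F i c / 𝔼 c, F i c) := by
      intro c
      have h1 : ∏ i ∈ s, F i c ^ w i =
          (∏ i ∈ s, (𝔼 c, F i c) ^ w i) * ∏ i ∈ s, (F i c / 𝔼 c, F i c) ^ w i := by
        rw [← prod_mul_distrib]
        refine prod_congr rfl fun i hi => ?_
        by_cases hwi : w i = 0
        · simp [hwi]
        · rw [← Real.mul_rpow (hm i hi) (div_nonneg (hF i hi c) (hm i hi)),
            mul_div_cancel₀ _ (hbad i hi hwi)]
      rw [h1]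
      exact mul_le_mul_of_nonneg_left
        (Real.geom_mean_le_arith_mean_weighted s w _ hw hw1
          fun i hi => div_nonneg (hF i hi c) (hm i hi))
        (prod_nonneg fun i hi => Real.rpow_nonneg (hm i hi) _)
    refine (expect_le_expect fun c _ => hpt c).trans_eq ?_
    rw [← mul_expect, expect_sum_comm]
    convert mul_one _
    rw [← hw1]
    refine sum_congr rfl fun i hi => ?_
    rw [← mul_expect, ← expect_div]
    by_cases hwi : w i = 0
    · simp [hwi]
    · rw [div_self (hbad i hi hwi), mul_one]

/-- Resampling one coordinate does not change a uniform average. -/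
theorem expect_expect_update {V κ : Type*} [Fintype V] [DecidableEq V] [Fintype κ] [Nonempty κ]
    (y : V) (X : (V → κ) → ℝ) :
    𝔼 f : V → κ, 𝔼 c, X (Function.update f y c) = 𝔼 f, X f := by
  have h : 𝔼 p : (V → κ) × κ, X (Function.update p.1 y p.2) = 𝔼 p : (V → κ) × κ, X p.1 := by
    let e : (V → κ) × κ → (V → κ) × κ := fun p => (Function.update p.1 y p.2, p.1 y)
    have he : Function.Involutive e := fun p => by simp [e]
    exact Fintype.expect_equiv he.toPerm _ _ fun p => rfl
  rw [← univ_product_univ, expect_product, expect_product] at h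
  simpa using h

section Peeling

variable {V κ : Type*} [DecidableEq κ]

/-- The indicator that `f` gives `v` a color different from those of all vertices of `P`. -/
def avoidIndicator (P : Finset V) (v : V) (f : V → κ) : ℝ := if f v ∈ P.image f then 0 else 1

/-- The proportion of colors not used by `f` on `P`. -/
noncomputable def freeFraction [Fintype κ] (P : Finset V) (f : V → κ) : ℝ :=
  𝔼 c : κ, if c ∈ P.image f then 0 else 1

theorem freeFraction_nonneg [Fintype κ] (P : Finset V) (f : V → κ) : 0 ≤ freeFraction P f :=
  expect_nonneg fun c _ => by split_ifs <;> norm_num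

theorem avoidIndicator_nonneg (P : Finset V) (v : V) (f : V → κ) : 0 ≤ avoidIndicator P v f := by
  unfold avoidIndicator; split_ifs <;> norm_num

variable [DecidableEq V]

theorem image_update_of_notMem {P : Finset V} {y : V} (hy : y ∉ P) (f : V → κ) (c : κ) :
    P.image (Function.update f y c) = P.image f :=
  image_congr fun _ hu => Function.update_of_ne (ne_of_mem_of_not_mem (mem_coe.1 hu) hy) _ _

variable [Fintype κ]

theorem expect_avoidIndicator_update {P : Finset V} {y : V} (hy : y ∉ P) (f : V → κ) :
    𝔼 c, avoidIndicator P y (Function.update f y c) = freeFraction P f := by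
  simp [avoidIndicator, freeFraction, image_update_of_notMem hy]

variable [Nonempty κ] (G : SimpleGraph V) [DecidableRel G.Adj]

/-- Averaging over the color of one vertex. -/
theorem expect_avoidIndicator_mul_prod_le {d : ℕ} (hd : 0 < d) {P s : Finset V} {y : V}
    (hyP : y ∉ P) (hys : y ∉ s) (H : V → (V → κ) → ℝ) (hH : ∀ w f, 0 ≤ H w f)
    (hind : ∀ w ∈ s, ¬ G.Adj y w → ∀ f c, H w (Function.update f y c) = H w f)
    (hcard : #P + #{w ∈ s | G.Adj y w} = d) (f : V → κ) :
    𝔼 c, avoidIndicator P y (Function.update f y c) *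
        ∏ w ∈ s, H w (Function.update f y c) ^ (1 / d : ℝ) ≤
      (freeFraction P f ^ #P) ^ (1 / d : ℝ) *
        ∏ w ∈ s, (𝔼 c, H w (Function.update f y c)) ^ (1 / d : ℝ) := by
  classical
  have hd' : (d : ℝ) ≠ 0 := by positivity
  set t := s.filter (G.Adj y) with ht
  have hyt : y ∉ t := fun h => hys (mem_filter.1 h).1
  let w : V → ℝ := fun v => if v = y then #P / d else 1 / d
  let F : V → κ → ℝ := fun v c =>
    if v = y then avoidIndicator P y (Function.update f y c) else H v (Function.update f y c)
  have hne : ∀ v ∈ t, v ≠ y := fun v hv h => hyt (h ▸ hv)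
  have key := expect_prod_rpow_le (insert y t) w F
    (fun v _ => by dsimp only [w]; split_ifs <;> positivity)
    (by
      rw [sum_insert hyt, sum_congr rfl fun v hv => if_neg (hne v hv)]
      simp only [w, if_true, sum_const, nsmul_eq_mul]
      rw [← hcard] at hd' ⊢
      push_cast at hd' ⊢
      field_simp)
    (fun v _ c => by
      dsimp only [F]; split_ifs
      exacts [avoidIndicator_nonneg _ _ _, hH _ _])
  have hF : ∀ c, ∏ v ∈ insert y t, F v c ^ w v =
      avoidIndicator P y (Function.update f y c) ^ (#P / d : ℝ) *
        ∏ v ∈ t, H v (Function.update f y c) ^ (1 / d : ℝ) := fun c => by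
    rw [prod_insert hyt]
    congr 1
    · simp [F, w]
    · exact prod_congr rfl fun v hv => by simp [F, w, hne v hv]
  have hF2 : ∏ v ∈ insert y t, (𝔼 c, F v c) ^ w v =
      freeFraction P f ^ (#P / d : ℝ) *
        ∏ v ∈ t, (𝔼 c, H v (Function.update f y c)) ^ (1 / d : ℝ) := by
    rw [prod_insert hyt]
    congr 1
    · simp [F, w, expect_avoidIndicator_update hyP]
    · exact prod_congr rfl fun v hv => by simp [F, w, hne v hv]
  simp only [hF, hF2] at key
  have hsplit : ∀ X : V → ℝ, ∏ v ∈ s, X v =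
      (∏ v ∈ t, X v) * ∏ v ∈ s with ¬ G.Adj y v, X v := fun X =>
    (prod_filter_mul_prod_filter_not s _ X).symm
  have hconst : ∀ c, ∏ v ∈ s with ¬ G.Adj y v, H v (Function.update f y c) ^ (1 / d : ℝ) =
      ∏ v ∈ s with ¬ G.Adj y v, H v f ^ (1 / d : ℝ) := fun c =>
    prod_congr rfl fun v hv => by rw [hind v (mem_filter.1 hv).1 (mem_filter.1 hv).2]
  have hconst2 : ∏ v ∈ s with ¬ G.Adj y v, (𝔼 c, H v (Function.update f y c)) ^ (1 / d : ℝ) =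
      ∏ v ∈ s with ¬ G.Adj y v, H v f ^ (1 / d : ℝ) :=
    prod_congr rfl fun v hv => by
      simp only [hind v (mem_filter.1 hv).1 (mem_filter.1 hv).2, Fintype.expect_const]
  rw [hsplit, hconst2, ← Real.rpow_natCast, ← Real.rpow_mul (freeFraction_nonneg _ _),
    mul_one_div, ← mul_assoc]
  refine le_trans ?_ (mul_le_mul_of_nonneg_right key
    (prod_nonneg fun v _ => Real.rpow_nonneg (hH _ _) _))
  rw [expect_mul]
  refine expect_le_expect fun c _ => ?_
  rw [hsplit, hconst, ← mul_assoc]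
  refine mul_le_mul_of_nonneg_right (mul_le_mul_of_nonneg_right ?_
    (prod_nonneg fun v _ => Real.rpow_nonneg (hH _ _) _))
    (prod_nonneg fun v _ => Real.rpow_nonneg (hH _ _) _)
  unfold avoidIndicator
  split_ifs
  · positivity
  · simp

variable [Fintype V] (r : V → ℕ)

/-- The neighbours of `v` of smaller rank. -/
def earlierNeighbors (v : V) : Finset V := {u | G.Adj v u ∧ r u < r v}

/-- Peeling off the vertices of a lower set `A` from the last one: each `H w` is a function of the
colors of the neighbours of `w` in `A`. -/
theorem expect_prod_avoidIndicator_mul_prod_le {d : ℕ} (hd : 0 < d) (hG : G.IsRegularOfDegree d)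
    (hr : Function.Injective r) (A : Finset V) :
    (∀ u, ∀ v ∈ A, r u < r v → u ∈ A) → ∀ H : V → (V → κ) → ℝ, (∀ w f, 0 ≤ H w f) →
    (∀ w ∉ A, ∀ f g, (∀ u ∈ A, G.Adj w u → f u = g u) → H w f = H w g) →
    𝔼 f, (∏ v ∈ A, avoidIndicator (earlierNeighbors G r v) v f) *
        ∏ w ∈ Aᶜ, H w f ^ (1 / d : ℝ) ≤
      (∏ v ∈ A, (𝔼 f : V → κ, freeFraction (earlierNeighbors G r v) f ^
        #(earlierNeighbors G r v)) ^ (1 / d : ℝ)) * ∏ w ∈ Aᶜ, (𝔼 f, H w f) ^ (1 / d : ℝ) := by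
  induction A using Finset.induction_on_max_value r with
  | empty =>
    intro _ H _ hdep
    have hc : ∀ w f, H w f = H w (fun _ => Classical.arbitrary κ) := fun w f =>
      hdep w (by simp) _ _ (by simp)
    simp only [prod_empty, one_mul]
    refine le_of_eq ?_
    rw [expect_congr rfl fun f _ => prod_congr rfl fun w _ => by rw [hc w f],
      Fintype.expect_const]
    refine prod_congr rfl fun w _ => ?_
    rw [expect_congr rfl fun f _ => hc w f, Fintype.expect_const]
  | insert y A hyA hmax ih =>
    intro hlow H hH hdep
    have hlt : ∀ x ∈ A, r x < r y := fun x hx =>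
      lt_of_le_of_ne (hmax x hx) fun h => hyA (hr h ▸ hx)
    have hlowA : ∀ u, ∀ v ∈ A, r u < r v → u ∈ A := fun u v hv huv => by
      rcases mem_insert.1 (hlow u v (mem_insert_of_mem hv) huv) with rfl | h
      · exact absurd (hlt v hv) (by omega)
      · exact h
    set P := earlierNeighbors G r y with hP
    have hPmem : ∀ u, u ∈ P ↔ G.Adj y u ∧ u ∈ A := fun u => by
      simp only [hP, earlierNeighbors, mem_filter, mem_univ, true_and]
      refine and_congr_right fun _ => ⟨fun h => ?_, hlt u⟩
      rcases mem_insert.1 (hlow u y (mem_insert_self _ _) h) with rfl | h'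
      · omega
      · exact h'
    have hyP : y ∉ P := fun h => hyA ((hPmem y).1 h).2
    have hys : y ∉ (insert y A)ᶜ := by simp
    have hcompl : Aᶜ = insert y (insert y A)ᶜ := by
      ext u; by_cases h : u = y <;> simp [h, hyA]
    have hcard : #P + #{w ∈ (insert y A)ᶜ | G.Adj y w} = d := by
      rw [← hG y, ← G.card_neighborFinset_eq_degree, ← card_union_of_disjoint]
      · congr 1
        ext u
        have : G.Adj y u → u ≠ y := fun h => h.ne'
        simp only [mem_union, hPmem, mem_filter, mem_compl, mem_insert,
          SimpleGraph.mem_neighborFinset]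
        tauto
      · rw [disjoint_left]
        intro u hu hu'
        simp only [mem_filter, mem_compl, mem_insert] at hu'
        exact hu'.1 (Or.inr ((hPmem u).1 hu).2)
    have hind : ∀ w ∈ (insert y A)ᶜ, ¬ G.Adj y w → ∀ f c,
        H w (Function.update f y c) = H w f := fun w hw hyw f c =>
      hdep w (mem_compl.1 hw) _ _ fun u _ hwu =>
        Function.update_of_ne (by rintro rfl; exact hyw hwu.symm) _ _
    let H' : V → (V → κ) → ℝ := fun w f =>
      if w = y then freeFraction P f ^ #P else 𝔼 c, H w (Function.update f y c)
    have hH'y : ∀ f, H' y f = freeFraction P f ^ #P := fun f => if_pos rfl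
    have hH'w : ∀ w ∈ (insert y A)ᶜ, ∀ f, H' w f = 𝔼 c, H w (Function.update f y c) :=
      fun w hw f => if_neg (ne_of_mem_of_not_mem hw hys)
    have hstep := ih hlowA H'
      (fun w f => by
        dsimp only [H']; split_ifs
        · exact pow_nonneg (freeFraction_nonneg _ _) _
        · exact expect_nonneg fun c _ => hH _ _)
      (fun w hw f g hfg => by
        dsimp only [H']
        split_ifs with h
        · subst h
          have : P.image f = P.image g :=
            image_congr fun u hu => hfg u ((hPmem u).1 hu).2 ((hPmem u).1 hu).1
          simp only [freeFraction, this]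
        · refine expect_congr rfl fun c _ => hdep w (by simp [h, hw]) _ _ fun u hu hwu => ?_
          by_cases huy : u = y
          · subst huy; simp
          · rw [Function.update_of_ne huy, Function.update_of_ne huy]
            exact hfg u ((mem_insert.1 hu).resolve_left huy) hwu)
    have hmean : ∏ w ∈ (insert y A)ᶜ, (𝔼 f, H' w f) ^ (1 / d : ℝ) =
        ∏ w ∈ (insert y A)ᶜ, (𝔼 f, H w f) ^ (1 / d : ℝ) := prod_congr rfl fun w hw => by
      rw [expect_congr rfl fun f _ => hH'w w hw f, expect_expect_update]
    rw [hcompl, prod_insert hys, expect_congr rfl fun f _ => hH'y f, hmean] at hstep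
    rw [prod_insert hyA]
    refine le_trans ?_ (hstep.trans_eq (by ring))
    rw [← expect_expect_update y]
    refine expect_le_expect fun f _ => ?_
    have hA : ∀ c, ∏ v ∈ A, avoidIndicator (earlierNeighbors G r v) v (Function.update f y c) =
        ∏ v ∈ A, avoidIndicator (earlierNeighbors G r v) v f := fun c =>
      prod_congr rfl fun v hv => by
        have h1 : y ∉ earlierNeighbors G r v := fun h => by
          simp only [earlierNeighbors, mem_filter] at h
          exact absurd (hlt v hv) (by omega)
        rw [avoidIndicator, avoidIndicator, image_update_of_notMem h1,
          Function.update_of_ne (ne_of_mem_of_not_mem hv hyA)]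
    have hH'f : ∏ w ∈ (insert y A)ᶜ, H' w f ^ (1 / d : ℝ) =
        ∏ w ∈ (insert y A)ᶜ, (𝔼 c, H w (Function.update f y c)) ^ (1 / d : ℝ) :=
      prod_congr rfl fun w hw => by rw [hH'w w hw f]
    rw [prod_insert hys, hH'y, hH'f]
    refine le_trans (le_of_eq ?_) (mul_le_mul_of_nonneg_left
      (expect_avoidIndicator_mul_prod_le G hd hyP hys H hH hind hcard f)
      (prod_nonneg fun v _ => avoidIndicator_nonneg _ _ _))
    rw [mul_expect]
    refine expect_congr rfl fun c _ => ?_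
    rw [prod_insert hyA, hA]
    ring

/-- The density of proper colorings is bounded by a product over the vertices that depends only on
the numbers of earlier neighbours. -/
theorem expect_prod_avoidIndicator_le {d : ℕ} (hd : 0 < d) (hG : G.IsRegularOfDegree d)
    (hr : Function.Injective r) :
    𝔼 f : V → κ, ∏ v, avoidIndicator (earlierNeighbors G r v) v f ≤
      ∏ v, (𝔼 f : V → κ, freeFraction (earlierNeighbors G r v) f ^
        #(earlierNeighbors G r v)) ^ (1 / d : ℝ) := by
  simpa using expect_prod_avoidIndicator_mul_prod_le G r hd hG hr univ (by simp)
    (fun (_ : V) (_ : V → κ) => (1 : ℝ)) (by simp) (by simp)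

end Peeling

/-- Each color set containing the image of `P` contributes the functions mapping `P` into it. -/
theorem sum_card_compl_image_pow_le {V κ : Type*} [Fintype V] [DecidableEq V] [Fintype κ]
    [DecidableEq κ] (P : Finset V) :
    (∑ f : V → κ, #(P.image f)ᶜ ^ #P) * Fintype.card κ ^ #P ≤
      (∑ A : Finset κ, (#A * #Aᶜ) ^ #P) * Fintype.card κ ^ Fintype.card V := by
  have hcount : ∀ A : Finset κ, #{f : V → κ | P.image f ⊆ A} * Fintype.card κ ^ #P =
      #A ^ #P * Fintype.card κ ^ Fintype.card V := fun A => by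
    have h1 : ({f : V → κ | P.image f ⊆ A} : Finset (V → κ)) =
        Fintype.piFinset fun v => if v ∈ P then A else univ := by
      ext f
      simp only [mem_filter, mem_univ, true_and, image_subset_iff, Fintype.mem_piFinset]
      refine forall_congr' fun v => ?_
      by_cases hv : v ∈ P <;> simp [hv]
    have h2 : ∏ v : V, #(if v ∈ P then A else univ) =
        #A ^ #P * Fintype.card κ ^ #Pᶜ := by
      rw [← prod_mul_prod_compl P, prod_congr rfl fun v hv => by rw [if_pos hv],
        prod_congr (s₁ := Pᶜ) rfl fun v hv => by rw [if_neg (mem_compl.1 hv)]]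
      simp
    rw [h1, Fintype.card_piFinset, h2, mul_assoc, ← pow_add, card_compl_add_card]
  calc (∑ f : V → κ, #(P.image f)ᶜ ^ #P) * Fintype.card κ ^ #P
      ≤ (∑ f : V → κ, ∑ A : Finset κ, if P.image f ⊆ A then #Aᶜ ^ #P else 0) *
          Fintype.card κ ^ #P := by
        refine Nat.mul_le_mul_right _ (sum_le_sum fun f _ => ?_)
        refine le_trans ?_ (single_le_sum (fun _ _ => Nat.zero_le _) (mem_univ (P.image f)))
        simp
    _ = ∑ A : Finset κ, #Aᶜ ^ #P * (#{f : V → κ | P.image f ⊆ A} * Fintype.card κ ^ #P) := by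
        rw [sum_comm, sum_mul]
        refine sum_congr rfl fun A _ => ?_
        rw [← sum_filter, sum_const, smul_eq_mul]
        ring
    _ = (∑ A : Finset κ, (#A * #Aᶜ) ^ #P) * Fintype.card κ ^ Fintype.card V := by
        rw [sum_mul]
        refine sum_congr rfl fun A _ => ?_
        rw [hcount, mul_pow]
        ring

theorem mul_sub_add_one_le_eta {q k : ℕ} (hk : k ≤ q) (h1 : k ≠ q / 2) (h2 : k ≠ (q + 1) / 2) :
    k * (q - k) + 1 ≤ eta q := by
  obtain ⟨l, rfl⟩ := Nat.exists_eq_add_of_le hk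
  rw [Nat.add_sub_cancel_left, eta]
  rcases Nat.even_or_odd' (k + l) with ⟨t, ht | ht⟩
  · rw [show (k + l) / 2 = t by omega, show (k + l + 1) / 2 = t by omega]
    have : k ≠ t := by omega
    rcases lt_or_gt_of_ne this with h | h
    · obtain ⟨s, rfl⟩ := Nat.exists_eq_add_of_lt h
      obtain rfl : l = k + 2 * s + 2 := by omega
      nlinarith
    · obtain ⟨s, rfl⟩ := Nat.exists_eq_add_of_lt h
      obtain rfl : t = l + s + 1 := by omega
      nlinarith
  · rw [show (k + l) / 2 = t by omega, show (k + l + 1) / 2 = t + 1 by omega]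
    rcases lt_or_gt_of_ne (show k ≠ t by omega) with h | h
    · obtain ⟨s, rfl⟩ := Nat.exists_eq_add_of_lt h
      obtain rfl : l = k + 2 * s + 3 := by omega
      nlinarith
    · obtain ⟨s, rfl⟩ := Nat.exists_eq_add_of_lt (show t + 1 < k by omega)
      obtain rfl : t = l + s + 1 := by omega
      nlinarith

theorem mul_sub_le_eta {q k : ℕ} (hk : k ≤ q) : k * (q - k) ≤ eta q := by
  by_cases h1 : k = q / 2
  · rw [eta, h1, show q - q / 2 = (q + 1) / 2 by omega]
  by_cases h2 : k = (q + 1) / 2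
  · rw [eta, h2, show q - (q + 1) / 2 = q / 2 by omega, mul_comm]
  exact (Nat.le_succ _).trans (mul_sub_add_one_le_eta hk h1 h2)

theorem card_balanced_le_mq (q : ℕ) :
    #{A : Finset (Fin q) | #A = q / 2 ∨ #A = (q + 1) / 2} ≤ mq q := by
  have hk : ∀ k, #{A : Finset (Fin q) | #A = k} = q.choose k := fun k => by
    simp
  unfold mq
  split_ifs with h
  · have : (q + 1) / 2 = q / 2 := by obtain ⟨t, ht⟩ := h; omega
    simp [this]
  · obtain ⟨t, rfl⟩ := Nat.not_even_iff_odd.1 h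
    rw [filter_or]
    refine (card_union_le _ _).trans ?_
    rw [hk, hk, show (2 * t + 1) / 2 = t by omega, show (2 * t + 1 + 1) / 2 = t + 1 by omega,
      Nat.choose_succ_succ]

theorem sum_card_mul_card_compl_pow_le (q p : ℕ) :
    ∑ A : Finset (Fin q), (#A * #Aᶜ) ^ p ≤ mq q * eta q ^ p + 2 ^ q * (eta q - 1) ^ p := by
  rw [← sum_filter_add_sum_filter_not univ
    fun A : Finset (Fin q) => #A = q / 2 ∨ #A = (q + 1) / 2]
  have hle : ∀ A : Finset (Fin q), #A ≤ q := fun A => by simpa using card_le_univ A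
  refine Nat.add_le_add ?_ ?_
  · refine (sum_le_card_nsmul _ _ (eta q ^ p) fun A _ => ?_).trans
      (Nat.mul_le_mul_right _ (card_balanced_le_mq q))
    rw [card_compl, Fintype.card_fin]
    exact Nat.pow_le_pow_left (mul_sub_le_eta (hle A)) _
  · refine (sum_le_card_nsmul _ _ ((eta q - 1) ^ p) fun A hA => ?_).trans
      (Nat.mul_le_mul_right _ ((card_filter_le _ _).trans (by simp)))
    simp only [mem_filter, mem_univ, true_and, not_or] at hA
    rw [card_compl, Fintype.card_fin]
    exact Nat.pow_le_pow_left (Nat.le_sub_one_of_lt (mul_sub_add_one_le_eta (hle A) hA.1 hA.2)) _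

theorem two_le_eta {q : ℕ} (hq : 3 ≤ q) : 2 ≤ eta q :=
  Nat.mul_le_mul (show 1 ≤ q / 2 by omega) (show 2 ≤ (q + 1) / 2 by omega)

theorem one_le_mq (q : ℕ) : 1 ≤ mq q := by
  unfold mq
  split_ifs <;> exact Nat.choose_pos (by omega)

theorem freeFraction_eq {V : Type*} {q : ℕ} (P : Finset V) (f : V → Fin q) :
    freeFraction P f = #(P.image f)ᶜ / q := by
  rw [freeFraction, Fintype.expect_eq_sum_div_card, Fintype.card_fin]
  congr 1
  rw [compl_eq_univ_sdiff, ← filter_notMem_eq_sdiff, card_filter]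
  push_cast
  exact sum_congr rfl fun c _ => (ite_not _ _ _).symm

theorem expect_freeFraction_pow_le {V : Type*} [Fintype V] [DecidableEq V] {q : ℕ} (hq : 3 ≤ q)
    (P : Finset V) :
    𝔼 f : V → Fin q, freeFraction P f ^ #P ≤
      (eta q / q ^ 2 : ℝ) ^ #P * (mq q * Real.exp (2 ^ q * (1 - 1 / eta q : ℝ) ^ #P)) := by
  have hη : (2 : ℝ) ≤ eta q := by exact_mod_cast two_le_eta hq
  have hm : (1 : ℝ) ≤ mq q := by exact_mod_cast one_le_mq q
  have hq0 : (0 : ℝ) < q := by exact_mod_cast (by omega : 0 < q)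
  have h1 : 𝔼 f : V → Fin q, freeFraction P f ^ #P ≤
      (∑ A : Finset (Fin q), (#A * #Aᶜ : ℝ) ^ #P) / (q ^ 2) ^ #P := by
    have h := sum_card_compl_image_pow_le (κ := Fin q) P
    rw [Fintype.card_fin] at h
    have h' : (∑ f : V → Fin q, (#(P.image f)ᶜ : ℝ) ^ #P) * q ^ #P ≤
        (∑ A : Finset (Fin q), (#A * #Aᶜ : ℝ) ^ #P) * q ^ Fintype.card V := by exact_mod_cast h
    simp only [freeFraction_eq, div_pow]
    rw [Fintype.expect_eq_sum_div_card, ← sum_div, Fintype.card_fun, Fintype.card_fin, div_div,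
      div_le_div_iff₀ (by positivity) (by positivity)]
    push_cast
    rw [← pow_mul, two_mul, pow_add, ← mul_assoc]
    calc _ ≤ (∑ A : Finset (Fin q), (#A * #Aᶜ : ℝ) ^ #P) * q ^ Fintype.card V * q ^ #P := by
          gcongr
      _ = _ := by ring
  have h2 : (∑ A : Finset (Fin q), (#A * #Aᶜ : ℝ) ^ #P) ≤
      mq q * eta q ^ #P + 2 ^ q * (eta q - 1 : ℝ) ^ #P := by
    have h := sum_card_mul_card_compl_pow_le q #P
    rw [← Nat.cast_le (α := ℝ)] at h
    push_cast [Nat.cast_sub (show 1 ≤ eta q from (two_le_eta hq).trans' one_le_two)] at h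
    exact h
  refine h1.trans ?_
  rw [div_pow, div_mul_eq_mul_div]
  gcongr
  refine h2.trans ?_
  have hr : (eta q - 1 : ℝ) ^ #P = eta q ^ #P * (1 - 1 / eta q : ℝ) ^ #P := by
    rw [← mul_pow]; congr 1; field_simp
  have hr0 : (0 : ℝ) ≤ (1 - 1 / eta q : ℝ) ^ #P := by
    refine pow_nonneg (sub_nonneg.2 ?_) _
    rw [div_le_one (by linarith)]; linarith
  have hexp := Real.add_one_le_exp (2 ^ q * (1 - 1 / eta q : ℝ) ^ #P)
  set x := (2 : ℝ) ^ q * (1 - 1 / eta q : ℝ) ^ #P with hx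
  have hx0 : 0 ≤ x := by positivity
  calc (mq q : ℝ) * eta q ^ #P + 2 ^ q * (eta q - 1 : ℝ) ^ #P
      = eta q ^ #P * (mq q + x) := by rw [hr, hx]; ring
    _ ≤ eta q ^ #P * (mq q * Real.exp x) := by
        gcongr
        nlinarith

/-- The ranks of the elements of `S` under an injective key are `0, …, #S - 1`. -/
theorem sum_pow_card_lt {V α : Type*} [LinearOrder α] {σ : V → α} (hσ : Function.Injective σ)
    (S : Finset V) (x : ℝ) :
    ∑ w ∈ S, x ^ #{u ∈ S | σ u < σ w} = ∑ k ∈ range #S, x ^ k := by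
  have hmono : ∀ v ∈ S, ∀ w, σ v < σ w → #{u ∈ S | σ u < σ v} < #{u ∈ S | σ u < σ w} :=
    fun v hv w hvw => card_lt_card <| (ssubset_iff_of_subset fun u hu => by
      simp only [mem_filter] at hu ⊢
      exact ⟨hu.1, hu.2.trans hvw⟩).2 ⟨v, by simp [hv, hvw], by simp⟩
  have hinj : Set.InjOn (fun w => #{u ∈ S | σ u < σ w}) S := fun v hv w hw h => by
    by_contra hne
    rcases lt_or_gt_of_ne (hσ.ne hne) with hlt | hlt
    · exact (hmono v hv w hlt).ne h
    · exact (hmono w hw v hlt).ne' h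
  have himage : S.image (fun w => #{u ∈ S | σ u < σ w}) = range #S :=
    eq_of_subset_of_card_le
      (image_subset_iff.2 fun w hw => mem_range.2 <| card_lt_card <|
        (ssubset_iff_of_subset (filter_subset _ _)).2 ⟨w, hw, by simp⟩)
      (by rw [card_image_of_injOn hinj, card_range])
  rw [← himage, sum_image hinj]

/-- In a uniformly random ordering, the rank of `v` within a set containing it is uniform. -/
theorem card_mul_expect_pow_rank {V : Type*} [Fintype V] [DecidableEq V] {S : Finset V} {v : V}
    (hv : v ∈ S) (x : ℝ) :
    #S * 𝔼 σ : V ≃ Fin (Fintype.card V), x ^ #{u ∈ S | σ u < σ v} = ∑ k ∈ range #S, x ^ k := by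
  have hsymm : ∀ w ∈ S, 𝔼 σ : V ≃ Fin (Fintype.card V), x ^ #{u ∈ S | σ u < σ w} =
      𝔼 σ : V ≃ Fin (Fintype.card V), x ^ #{u ∈ S | σ u < σ v} := fun w hw => by
    have hS : ∀ u ∈ S, Equiv.swap v w u ∈ S := fun u hu => by
      rw [Equiv.swap_apply_def]; split_ifs <;> assumption
    refine Fintype.expect_equiv (Equiv.equivCongr (Equiv.swap v w) (Equiv.refl _)) _ _ fun σ => ?_
    congr 1
    refine card_nbij' (Equiv.swap v w) (Equiv.swap v w) ?_ ?_
      (fun u _ => Equiv.swap_apply_self v w u) (fun u _ => Equiv.swap_apply_self v w u)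
    · intro u hu
      simp only [coe_filter, Set.mem_ofPred_eq] at hu ⊢
      exact ⟨hS u hu.1, by simpa using hu.2⟩
    · intro u hu
      simp only [coe_filter, Set.mem_ofPred_eq] at hu ⊢
      exact ⟨hS u hu.1, by simpa using hu.2⟩
  have : Nonempty (V ≃ Fin (Fintype.card V)) := ⟨Fintype.equivFin V⟩
  rw [← nsmul_eq_mul, ← sum_const, ← sum_congr rfl hsymm, ← expect_sum_comm,
    expect_congr rfl fun σ _ => sum_pow_card_lt σ.injective S x, Fintype.expect_const]

theorem sum_range_pow_le {x : ℝ} (hx0 : 0 ≤ x) (hx1 : x < 1) (m : ℕ) :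
    ∑ k ∈ range m, x ^ k ≤ (1 - x)⁻¹ := by
  rw [← one_div, le_div_iff₀ (sub_pos.2 hx1), mul_comm, mul_neg_geom_sum]
  linarith [pow_nonneg hx0 m]

/-- There is an ordering starting with the independent set `I` in which few vertices outside `I`
have few earlier neighbours. -/
theorem exists_rank_sum_pow_le {V : Type*} [Fintype V] [DecidableEq V] (G : SimpleGraph V)
    [DecidableRel G.Adj] {d : ℕ} (hG : G.IsRegularOfDegree d) {I : Finset V}
    (hI : ∀ v ∈ I, ∀ w ∈ I, ¬ G.Adj v w) {x : ℝ} (hx0 : 0 ≤ x) (hx1 : x < 1) :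
    ∃ r : V → ℕ, Function.Injective r ∧ (∀ v ∈ I, earlierNeighbors G r v = ∅) ∧
      ∑ v ∈ Iᶜ, x ^ #(earlierNeighbors G r v) ≤
        Fintype.card V * ((1 - x)⁻¹ ^ 2 / (d + 1)) := by
  let r : (V ≃ Fin (Fintype.card V)) → V → ℕ := fun σ v =>
    if v ∈ I then σ v else Fintype.card V + σ v
  have hinj : ∀ σ, Function.Injective (r σ) := fun σ u v h => by
    dsimp only [r] at h
    have hu := (σ u).isLt
    have hv := (σ v).isLt
    refine σ.injective (Fin.ext ?_)
    split_ifs at h <;> omega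
  have hfirst : ∀ σ, ∀ v ∈ I, earlierNeighbors G (r σ) v = ∅ := fun σ v hv => by
    refine filter_eq_empty_iff.2 fun u _ ⟨huv, hlt⟩ => ?_
    have hu : u ∉ I := fun hu => hI v hv u hu huv
    have := (σ v).isLt
    simp only [r, hu, hv, if_true, if_false] at hlt
    omega
  have : Nonempty (V ≃ Fin (Fintype.card V)) := ⟨Fintype.equivFin V⟩
  have hxinv : 0 < (1 - x)⁻¹ := inv_pos.2 (sub_pos.2 hx1)
  have hmean : ∀ v ∈ Iᶜ, 𝔼 σ, x ^ #(earlierNeighbors G (r σ) v) ≤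
      (1 - x)⁻¹ ^ 2 / (d + 1) := fun v hv => by
    rw [mem_compl] at hv
    set a := #{u | G.Adj v u ∧ u ∉ I} with ha
    set b := #{u | G.Adj v u ∧ u ∈ I} with hb
    have hab : a + b = d := by
      rw [← hG v, ← G.card_neighborFinset_eq_degree, G.neighborFinset_eq_filter, add_comm,
        ← card_filter_add_card_filter_not (s := {w | G.Adj v w}) (· ∈ I), filter_filter,
        filter_filter]
    set S : Finset V := insert v ({u | G.Adj v u ∧ u ∉ I} : Finset V) with hS
    have hScard : #S = a + 1 := card_insert_of_notMem (by simp)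
    have hearlier : ∀ σ, #(earlierNeighbors G (r σ) v) = b + #{u ∈ S | σ u < σ v} := fun σ => by
      rw [hb, ← card_union_of_disjoint]
      · congr 1
        ext u
        have := (σ u).isLt
        by_cases hu : u ∈ I
        · have hne : u ≠ v := by rintro rfl; exact hv hu
          simp [earlierNeighbors, r, hu, hv, hS, hne]
          omega
        · by_cases huv : u = v
          · simp [earlierNeighbors, r, hv, hS, huv]
          · simp [earlierNeighbors, r, hu, hv, hS, huv]
      · rw [disjoint_left]
        intro u hu hu'
        simp only [hS, mem_filter, mem_univ, true_and, mem_insert] at hu hu'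
        rcases hu'.1 with rfl | h
        · exact hv hu.2
        · exact h.2 hu.2
    have hrank := card_mul_expect_pow_rank (mem_insert_self v _ : v ∈ S) x
    rw [hScard] at hrank
    push_cast at hrank
    have hb1 : (b + 1) * x ^ b ≤ (1 - x)⁻¹ := by
      refine le_trans ?_ (sum_range_pow_le hx0 hx1 (b + 1))
      have := card_nsmul_le_sum (range (b + 1)) (fun k => x ^ k) (x ^ b) fun k hk =>
        pow_le_pow_of_le_one hx0 hx1.le (Nat.lt_succ_iff.1 (mem_range.1 hk))
      simpa using this
    have hd : (d + 1 : ℝ) ≤ (a + 1) * (b + 1) := by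
      rw [← hab]; push_cast; nlinarith [(Nat.cast_nonneg a : (0 : ℝ) ≤ a),
        (Nat.cast_nonneg b : (0 : ℝ) ≤ b), mul_nonneg (Nat.cast_nonneg a : (0 : ℝ) ≤ a)
        (Nat.cast_nonneg b : (0 : ℝ) ≤ b)]
    simp only [hearlier, pow_add]
    rw [← mul_expect, le_div_iff₀ (by positivity)]
    set E := 𝔼 σ : V ≃ Fin (Fintype.card V), x ^ #{u ∈ S | σ u < σ v} with hE
    have hE0 : 0 ≤ E := expect_nonneg fun σ _ => pow_nonneg hx0 _
    calc x ^ b * E * (d + 1) ≤ x ^ b * E * ((a + 1) * (b + 1)) := by gcongr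
      _ = ((b + 1) * x ^ b) * ((a + 1) * E) := by ring
      _ ≤ (1 - x)⁻¹ * (1 - x)⁻¹ := by
          rw [hrank]
          gcongr
          exact sum_range_pow_le hx0 hx1 _
      _ = _ := by ring
  obtain ⟨σ, -, hσ⟩ := exists_le_of_expect_le
    (univ_nonempty (α := V ≃ Fin (Fintype.card V)))
    (f := fun σ => ∑ v ∈ Iᶜ, x ^ #(earlierNeighbors G (r σ) v))
    (a := Fintype.card V * ((1 - x)⁻¹ ^ 2 / (d + 1))) (by
      rw [expect_sum_comm]
      refine (sum_le_card_nsmul _ _ _ hmean).trans ?_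
      rw [nsmul_eq_mul]
      gcongr
      exact card_le_univ _)
  exact ⟨r σ, hinj σ, hfirst σ, hσ⟩

theorem two_mul_sum_card_earlierNeighbors {V : Type*} [Fintype V] [DecidableEq V]
    (G : SimpleGraph V) [DecidableRel G.Adj] {d : ℕ} (hG : G.IsRegularOfDegree d) {r : V → ℕ}
    (hr : Function.Injective r) :
    2 * ∑ v, #(earlierNeighbors G r v) = Fintype.card V * d := by
  have hswap : ∑ v, #(earlierNeighbors G r v) = ∑ v, #{u | G.Adj v u ∧ r v < r u} := by
    simp only [earlierNeighbors, card_filter]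
    rw [sum_comm]
    simp only [G.adj_comm]
  have hdeg : ∀ v, #(earlierNeighbors G r v) + #{u | G.Adj v u ∧ r v < r u} = d := fun v => by
    rw [← hG v, ← G.card_neighborFinset_eq_degree, G.neighborFinset_eq_filter,
      ← card_filter_add_card_filter_not (s := {w | G.Adj v w}) (fun u => r u < r v),
      filter_filter, filter_filter]
    congr 2
    ext u
    simp only [mem_filter, mem_univ, true_and]
    refine and_congr_right fun h => ?_
    have := hr.ne h.ne
    omega
  rw [two_mul]
  nth_rewrite 2 [hswap]
  rw [← sum_add_distrib, sum_congr rfl fun v _ => hdeg v]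
  simp

theorem numColorings_div_pow_eq_expect {V : Type*} [Fintype V] [DecidableEq V] (G : SimpleGraph V)
    [DecidableRel G.Adj] {r : V → ℕ} (hr : Function.Injective r) (q : ℕ) :
    (numColorings G q : ℝ) / q ^ Fintype.card V =
      𝔼 f : V → Fin q, ∏ v, avoidIndicator (earlierNeighbors G r v) v f := by
  classical
  have hprod : ∀ f : V → Fin q, ∏ v, avoidIndicator (earlierNeighbors G r v) v f =
      if ∀ v w, G.Adj v w → f v ≠ f w then 1 else 0 := fun f => by
    split_ifs with h
    · refine prod_eq_one fun v _ => if_neg fun hv => ?_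
      obtain ⟨u, hu, huv⟩ := mem_image.1 hv
      exact h v u (mem_filter.1 hu).2.1 huv.symm
    · push Not at h
      obtain ⟨v, w, hvw, hf⟩ := h
      rcases lt_or_gt_of_ne (hr.ne hvw.ne) with hlt | hlt
      · exact prod_eq_zero (mem_univ w) (if_pos (mem_image.2
          ⟨v, by simp [earlierNeighbors, hvw.symm, hlt], hf⟩))
      · exact prod_eq_zero (mem_univ v) (if_pos (mem_image.2
          ⟨w, by simp [earlierNeighbors, hvw, hlt], hf.symm⟩))
  simp only [hprod]
  rw [Fintype.expect_eq_sum_div_card, sum_boole, Fintype.card_fun, Fintype.card_fin, numColorings,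
    Nat.card_eq_fintype_card, Fintype.card_subtype]
  push_cast
  rfl

theorem exists_indep_card_eq_indepNum {V : Type*} [Fintype V] (G : SimpleGraph V) :
    ∃ I : Finset V, (∀ v ∈ I, ∀ w ∈ I, ¬ G.Adj v w) ∧ #I = indepNum G :=
  Nat.sSup_mem (s := {k | ∃ s : Finset V, (∀ v ∈ s, ∀ w ∈ s, ¬ G.Adj v w) ∧ #s = k})
    ⟨0, ∅, by simp⟩ ⟨Fintype.card V, by rintro k ⟨s, -, rfl⟩; exact card_le_univ s⟩

/-- An upper bound on the number of colorings in terms of an independent set. -/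
theorem numColorings_le_of_indep {V : Type*} [Fintype V] [DecidableEq V] (G : SimpleGraph V)
    [DecidableRel G.Adj] {q d : ℕ} (hq : 3 ≤ q) (hd : 0 < d) (hG : G.IsRegularOfDegree d)
    {I : Finset V} (hI : ∀ v ∈ I, ∀ w ∈ I, ¬ G.Adj v w) :
    (numColorings G q : ℝ) ≤ (eta q : ℝ) ^ (Fintype.card V / 2 : ℝ) *
      (mq q : ℝ) ^ (#Iᶜ / d : ℝ) *
        Real.exp (2 ^ q * eta q ^ 2) ^ (Fintype.card V / d ^ 2 : ℝ) := by
  have hη : (2 : ℝ) ≤ eta q := by exact_mod_cast two_le_eta hq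
  have hm : (1 : ℝ) ≤ mq q := by exact_mod_cast one_le_mq q
  have hq0 : (0 : ℝ) < q := by exact_mod_cast (by omega : 0 < q)
  have hd0 : (0 : ℝ) < d := by exact_mod_cast hd
  set x : ℝ := 1 - 1 / eta q with hx
  have hx0 : 0 ≤ x := by
    rw [hx, sub_nonneg, div_le_one (by linarith)]; linarith
  have hx1 : x < 1 := by
    rw [hx]; linarith [show (0 : ℝ) < 1 / eta q by positivity]
  have hxinv : (1 - x)⁻¹ = eta q := by rw [hx]; simp
  obtain ⟨r, hr, hfirst, hsum⟩ := exists_rank_sum_pow_le G hG hI hx0 hx1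
  rw [hxinv] at hsum
  have : Nonempty (Fin q) := ⟨⟨0, by omega⟩⟩
  set p : V → ℕ := fun v => #(earlierNeighbors G r v) with hp
  have hhand : (∑ v, (p v : ℝ)) / d = Fintype.card V / 2 := by
    have h : (2 : ℝ) * ∑ v, (p v : ℝ) = Fintype.card V * d := by
      exact_mod_cast two_mul_sum_card_earlierNeighbors G hG hr
    field_simp
    linarith
  have hfactor : ∀ v, 𝔼 f : V → Fin q, freeFraction (earlierNeighbors G r v) f ^ p v ≤
      (eta q / q ^ 2 : ℝ) ^ p v * if v ∈ Iᶜ then mq q * Real.exp (2 ^ q * x ^ p v) else 1 :=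
    fun v => by
      split_ifs with hv
      · exact expect_freeFraction_pow_le hq _
      · have : p v = 0 := by simp [hp, hfirst v (by simpa using hv)]
        simp [this]
  have hmain : (numColorings G q : ℝ) / q ^ Fintype.card V ≤
      ∏ v, ((eta q / q ^ 2 : ℝ) ^ p v *
        if v ∈ Iᶜ then mq q * Real.exp (2 ^ q * x ^ p v) else 1) ^ (1 / d : ℝ) := by
    rw [numColorings_div_pow_eq_expect G hr]
    refine (expect_prod_avoidIndicator_le G r hd hG hr).trans
      (prod_le_prod (fun v _ => Real.rpow_nonneg
        (expect_nonneg fun f _ => pow_nonneg (freeFraction_nonneg _ _) _) _) fun v _ => ?_)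
    exact Real.rpow_le_rpow
      (expect_nonneg fun f _ => pow_nonneg (freeFraction_nonneg _ _) _) (hfactor v) (by positivity)
  have hpow : ∀ {b : ℝ}, 0 ≤ b → ∀ k : ℕ, (b ^ k) ^ (1 / d : ℝ) = b ^ (k / d : ℝ) :=
    fun hb k => by rw [← Real.rpow_natCast, ← Real.rpow_mul hb, mul_one_div]
  have hprod : ∏ v, ((eta q / q ^ 2 : ℝ) ^ p v *
        if v ∈ Iᶜ then mq q * Real.exp (2 ^ q * x ^ p v) else 1) ^ (1 / d : ℝ) =
      (eta q : ℝ) ^ (Fintype.card V / 2 : ℝ) / q ^ Fintype.card V *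
        ((mq q : ℝ) ^ (#Iᶜ / d : ℝ) * Real.exp (2 ^ q * (∑ v ∈ Iᶜ, x ^ p v) / d)) := by
    rw [Real.finsetProd_rpow _ _ fun v _ => by split_ifs <;> positivity, prod_mul_distrib,
      prod_ite_mem, univ_inter, prod_mul_distrib, prod_const, ← Real.exp_sum, ← mul_sum,
      prod_pow_eq_pow_sum, Real.mul_rpow (by positivity) (by positivity),
      Real.mul_rpow (by positivity) (by positivity), ← Real.exp_mul, mul_one_div,
      hpow (by positivity), hpow (by positivity)]
    push_cast
    rw [hhand, Real.div_rpow (by positivity) (by positivity)]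
    congr 2
    rw [← Real.rpow_natCast, ← Real.rpow_natCast, ← Real.rpow_mul hq0.le]
    congr 1
    push_cast
    ring
  rw [hprod, div_mul_eq_mul_div, div_le_div_iff_of_pos_right (by positivity), ← mul_assoc] at hmain
  refine hmain.trans ?_
  rw [← Real.exp_mul]
  gcongr
  calc 2 ^ q * (∑ v ∈ Iᶜ, x ^ p v) / d
      ≤ 2 ^ q * (Fintype.card V * (eta q ^ 2 / d)) / d := by
        gcongr
        refine hsum.trans ?_
        gcongr
        linarith
    _ = 2 ^ q * eta q ^ 2 * (Fintype.card V / d ^ 2) := by field_simp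

theorem colorings_large_indep_set_bound (q : ℕ) (hq : 3 ≤ q) :
    ∃ C : ℝ, 1 < C ∧
      ∀ (d n : ℕ), 2 ≤ d → d + 1 ≤ n →
        ∀ ε : ℝ, 0 ≤ ε → ε ≤ 1 →
          ∀ (G : SimpleGraph (Fin n)) [DecidableRel G.Adj],
            G.IsRegularOfDegree d →
            (n : ℝ) * (1 - ε) / 2 ≤ (indepNum G : ℝ) →
            (numColorings G q : ℝ) ≤
              (eta q : ℝ) ^ ((n : ℝ) / 2) *
                (mq q : ℝ) ^ ((n : ℝ) * (1 + ε) / (2 * d)) *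
                C ^ ((n : ℝ) / (d : ℝ) ^ 2) := by
  have hη : 0 < eta q := two_pos.trans_le (two_le_eta hq)
  refine ⟨Real.exp (2 ^ q * eta q ^ 2), Real.one_lt_exp_iff.2 (by positivity), ?_⟩
  intro d n hd _ ε _ _ G _ hG hα
  obtain ⟨I, hI, hIcard⟩ := exists_indep_card_eq_indepNum G
  have hbound := numColorings_le_of_indep G hq (by omega : 0 < d) hG hI
  rw [Fintype.card_fin] at hbound
  refine hbound.trans ?_
  have hm : (1 : ℝ) ≤ mq q := by exact_mod_cast one_le_mq q
  have hd0 : (0 : ℝ) < d := by exact_mod_cast (by omega : 0 < d)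
  have hcard : (#Iᶜ : ℝ) + #I = n := by
    exact_mod_cast (card_compl_add_card I).trans (Fintype.card_fin n)
  rw [← hIcard] at hα
  gcongr ?_ * ?_ ^ ?_ * ?_
  rw [← div_div]
  gcongr
  linarith
end

section
/- For every integer q ≥ 3 there exist constants c₁, c₂ > 0 (depending only on q) such that for all integers d ≥ 2 and n ≥ d+1, every real ε with 0 ≤ ε ≤ 1, and every simple n-vertex d-regular graph G whose independence number satisfies α(G) ≤ n(1−ε)/2, the number of proper q-colorings of G satisfies c_q(G) ≤ η(q)^{n/2} · 2^{c₁·n·√((log d)/d) − c₂·ε·n}. -/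
open Finset

section Containers

variable {V : Type*} [Fintype V] [DecidableEq V] (G : SimpleGraph V) [DecidableRel G.Adj]

/-- The set of vertices adjacent to some vertex of `T`. -/
def nbhd (T : Finset V) : Finset V := T.biUnion fun v => G.neighborFinset v

/-- The vertices outside `nbhd G T` with fewer than `φ` neighbours outside `nbhd G T`. -/
noncomputable def container (φ : ℝ) (T : Finset V) : Finset V :=
  univ.filter fun v => v ∉ nbhd G T ∧ (#(G.neighborFinset v \ nbhd G T) : ℝ) < φ

theorem nbhd_insert (v : V) (T : Finset V) :
    nbhd G (insert v T) = G.neighborFinset v ∪ nbhd G T := by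
  simp [nbhd, Finset.biUnion_insert]

/-- Every independent set has a small subset whose container covers it. -/
theorem exists_fingerprint {φ : ℝ} (hφ : 0 < φ) (I : Finset V)
    (hI : ∀ v ∈ I, ∀ w ∈ I, ¬ G.Adj v w) :
    ∃ T : Finset V, (#T : ℝ) * φ ≤ Fintype.card V ∧ I ⊆ container G φ T := by
  classical
  obtain ⟨T, hT, hmax⟩ := exists_max_image
    (I.powerset.filter fun T => (#T : ℝ) * φ ≤ #(nbhd G T)) card ⟨∅, by simp⟩
  simp only [mem_filter, mem_powerset] at hT hmax
  obtain ⟨hTI, hTφ⟩ := hT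
  refine ⟨T, hTφ.trans (by exact_mod_cast card_le_univ _), fun v hv => ?_⟩
  simp only [container, mem_filter, mem_univ, true_and]
  refine ⟨fun hmem => ?_, ?_⟩
  · obtain ⟨w, hw, hwv⟩ := mem_biUnion.mp hmem
    exact hI w (hTI hw) v hv (by simpa using hwv)
  · by_contra! hge
    have hvT : v ∉ T := fun hvT => by
      have : G.neighborFinset v \ nbhd G T = ∅ :=
        sdiff_eq_empty_iff_subset.mpr (subset_biUnion_of_mem (fun v => G.neighborFinset v) hvT)
      rw [this] at hge
      simp at hge
      linarith
    have := hmax (insert v T) ⟨insert_subset hv hTI, by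
      rw [nbhd_insert, card_insert_of_notMem hvT, ← sdiff_union_self_eq_union,
        card_union_of_disjoint sdiff_disjoint]
      push_cast
      linarith⟩
    rw [card_insert_of_notMem hvT] at this
    omega

/-- In a `d`-regular graph containers have at most `(1 + φ / d) / 2` of the vertices. -/
theorem card_container_le {d : ℕ} (hd : 0 < d) (hG : G.IsRegularOfDegree d) {φ : ℝ}
    (hφ : 0 ≤ φ) (hφd : φ ≤ d) (T : Finset V) :
    (#(container G φ T) : ℝ) ≤ Fintype.card V / 2 * (1 + φ / d) := by
  set C := container G φ T with hC
  set L := nbhd G T with hL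
  have hdisj : Disjoint C L := disjoint_left.mpr fun v hv => by
    simp only [hC, container, mem_filter] at hv
    exact hv.2.1
  have hsum : (#C : ℝ) + #L ≤ Fintype.card V := by
    rw [← Nat.cast_add, ← card_union_of_disjoint hdisj]
    exact_mod_cast card_le_univ _
  have hlow : ∀ v ∈ C, (d : ℝ) - φ ≤ #(L.bipartiteAbove G.Adj v) := fun v hv => by
    simp only [hC, container, mem_filter] at hv
    have h1 : L.bipartiteAbove G.Adj v = G.neighborFinset v ∩ L := by
      ext w; simp [bipartiteAbove, and_comm]
    have h2 := card_sdiff_add_card_inter (G.neighborFinset v) L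
    rw [G.card_neighborFinset_eq_degree, hG v] at h2
    have h3 : ((#(G.neighborFinset v \ L) : ℕ) : ℝ) + #(G.neighborFinset v ∩ L) = d := by
      exact_mod_cast h2
    rw [h1]
    linarith [hv.2.2]
  have hup : ∀ w ∈ L, (#(C.bipartiteBelow G.Adj w) : ℝ) ≤ d := fun w _ => by
    rw [← hG w, ← G.card_neighborFinset_eq_degree]
    exact_mod_cast card_le_card fun v hv => by
      simp only [bipartiteBelow, mem_filter] at hv
      simpa using hv.2.symm
  have hcount : (#C : ℝ) * (d - φ) ≤ #L * d := by
    calc (#C : ℝ) * (d - φ) ≤ ∑ v ∈ C, (#(L.bipartiteAbove G.Adj v) : ℝ) := by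
          simpa using card_nsmul_le_sum C _ _ hlow
      _ = ∑ w ∈ L, (#(C.bipartiteBelow G.Adj w) : ℝ) := by
          exact_mod_cast sum_card_bipartiteAbove_eq_sum_card_bipartiteBelow G.Adj
      _ ≤ #L * d := by simpa using sum_le_card_nsmul L _ _ hup
  have hd' : (0 : ℝ) < d := by exact_mod_cast hd
  have hmul : (#C : ℝ) * (2 * d - φ) ≤ Fintype.card V * d := by nlinarith
  have hpos : (0 : ℝ) < 2 * d - φ := by linarith
  rw [← le_div_iff₀ hpos] at hmul
  refine hmul.trans ?_
  rw [div_le_iff₀ hpos]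
  have hn : (0 : ℝ) ≤ Fintype.card V := by positivity
  have : Fintype.card V / 2 * (1 + φ / d) * (2 * d - φ)
      = Fintype.card V * d + Fintype.card V * (φ * (d - φ)) / (2 * d) := by
    field_simp
    ring
  rw [this]
  have : 0 ≤ Fintype.card V * (φ * (d - φ)) / (2 * d) := by
    have : 0 ≤ (d : ℝ) - φ := by linarith
    positivity
  linarith

end Containers

section Lists

variable {V κ : Type*} [DecidableEq V] [Fintype κ] [DecidableEq κ]

/-- Requiring different values at `u` and `v`, for a family of functions that is closed under
giving `u` and `v` a common colour `i`, loses at least a `1 / |κ|²` proportion. -/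
theorem card_filter_ne_le (X : Finset (V → κ)) {u v : V} (huv : u ≠ v) (i : κ)
    (hX : ∀ g ∈ X, Function.update (Function.update g u i) v i ∈ X) (hκ : 0 < Fintype.card κ) :
    (#(X.filter fun g => g u ≠ g v) : ℝ) ≤ (1 - 1 / (Fintype.card κ : ℝ) ^ 2) * #X := by
  have hinj : #X ≤ #(X.filter (fun g => ¬ g u ≠ g v) ×ˢ (univ : Finset (κ × κ))) := by
    refine card_le_card_of_injOn
      (fun g => (Function.update (Function.update g u i) v i, (g u, g v))) ?_ ?_
    · intro g hg
      simp [hX g hg, Function.update_of_ne huv]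
    · intro g _ h _ hgh
      simp only [Prod.mk.injEq] at hgh
      obtain ⟨h1, h2, h3⟩ := hgh
      funext w
      rcases eq_or_ne w v with rfl | hwv
      · exact h3
      rcases eq_or_ne w u with rfl | hwu
      · exact h2
      simpa [hwv, hwu] using congrFun h1 w
  rw [card_product, card_univ, Fintype.card_prod] at hinj
  have hsplit := card_filter_add_card_filter_not (s := X) fun g => g u ≠ g v
  have hinj' : (#X : ℝ) ≤
      #(X.filter fun g => ¬ g u ≠ g v) * (Fintype.card κ : ℝ) ^ 2 := by
    rw [sq]; exact_mod_cast hinj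
  have hsplit' : (#(X.filter fun g => g u ≠ g v) : ℝ) + #(X.filter fun g => ¬ g u ≠ g v) = #X := by
    exact_mod_cast hsplit
  have hκ' : (0 : ℝ) < (Fintype.card κ : ℝ) ^ 2 := by positivity
  rw [← div_le_iff₀ hκ'] at hinj'
  rw [sub_mul, div_mul_eq_mul_div, one_mul]
  linarith

/-- If the colour `i` is available on all of `S`, each edge of a matching in `S` costs list
colourings a constant factor, and a maximal matching covers all but an independent set. -/
theorem card_list_colorings_le [Fintype V] (G : SimpleGraph V) {a : ℕ}
    (ha : ∀ s : Finset V, (∀ v ∈ s, ∀ w ∈ s, ¬ G.Adj v w) → #s ≤ a) (A : V → Finset κ) (i : κ)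
    (S : Finset V) (hS : ∀ v ∈ S, i ∈ A v) (P : (V → κ) → Prop) [DecidablePred P]
    (hP : ∀ g, P g ↔ ∀ v ∈ S, ∀ w ∈ S, G.Adj v w → g v ≠ g w) :
    ∃ m : ℕ, #S ≤ 2 * m + a ∧
      (#((Fintype.piFinset A).filter P) : ℝ) ≤
        (1 - 1 / (Fintype.card κ : ℝ) ^ 2) ^ m * ∏ v, (#(A v) : ℝ) := by
  classical
  have hκ : 0 < Fintype.card κ := Fintype.card_pos_iff.mpr ⟨i⟩
  have hγ : 0 ≤ 1 - 1 / (Fintype.card κ : ℝ) ^ 2 := by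
    rw [sub_nonneg, div_le_one (by positivity)]
    exact one_le_pow₀ (by exact_mod_cast hκ)
  induction S using Finset.strongInduction generalizing P with
  | H S ih =>
  by_cases hind : ∀ v ∈ S, ∀ w ∈ S, ¬ G.Adj v w
  · refine ⟨0, by simpa using ha S hind, ?_⟩
    rw [pow_zero, one_mul]
    calc (#((Fintype.piFinset A).filter P) : ℝ) ≤ #(Fintype.piFinset A) := by
          exact_mod_cast card_filter_le _ _
      _ = _ := by rw [Fintype.card_piFinset]; push_cast; rfl
  · push Not at hind
    obtain ⟨u, hu, v, hv, huv⟩ := hind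
    have hne : u ≠ v := huv.ne
    set R := (S.erase u).erase v with hR
    have hRS : R ⊂ S := (erase_subset _ _).trans_ssubset (erase_ssubset hu)
    set Q : (V → κ) → Prop := fun g => ∀ x ∈ R, ∀ y ∈ R, G.Adj x y → g x ≠ g y with hQ
    obtain ⟨m, hm, hcard⟩ := ih R hRS (fun x hx => hS x (hRS.1 hx)) Q (fun g => Iff.rfl)
    refine ⟨m + 1, ?_, ?_⟩
    · have h1 : #(S.erase u) + 1 = #S := card_erase_add_one hu
      have h2 : #R + 1 = #(S.erase u) := card_erase_add_one (mem_erase.mpr ⟨hne.symm, hv⟩)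
      omega
    · have hsub : (Fintype.piFinset A).filter P ⊆
          ((Fintype.piFinset A).filter Q).filter fun g => g u ≠ g v := by
        intro g hg
        simp only [mem_filter, hP] at hg ⊢
        exact ⟨⟨hg.1, fun x hx y hy => hg.2 x (hRS.1 hx) y (hRS.1 hy)⟩, hg.2 u hu v hv huv⟩
      have hstep := card_filter_ne_le ((Fintype.piFinset A).filter Q) hne i (fun g hg => by
        simp only [mem_filter, Fintype.mem_piFinset] at hg ⊢
        have hout : ∀ x ∈ R, Function.update (Function.update g u i) v i x = g x := by
          intro x hx
          simp only [hR, mem_erase] at hx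
          simp [hx.1, hx.2.1]
        refine ⟨fun x => ?_, fun x hx y hy hxy => ?_⟩
        · rcases eq_or_ne x v with rfl | hxv
          · simpa using hS x hv
          rcases eq_or_ne x u with rfl | hxu
          · simpa [hxv] using hS x hu
          simpa [hxv, hxu] using hg.1 x
        · rw [hout x hx, hout y hy]
          exact hg.2 x hx y hy hxy) hκ
      calc (#((Fintype.piFinset A).filter P) : ℝ)
          ≤ #(((Fintype.piFinset A).filter Q).filter fun g => g u ≠ g v) := by
            exact_mod_cast card_le_card hsub
        _ ≤ _ := hstep
        _ ≤ _ := mul_le_mul_of_nonneg_left hcard hγ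
        _ = _ := by rw [pow_succ]; ring

end Lists

section Estimates

/-- Among natural numbers `k`, the quantity `k / (1 + 1 / f) ^ k` is maximal at `k = f`. -/
theorem natCast_le_mul_rpow {f : ℕ} (hf : 0 < f) (k : ℕ) :
    (k : ℝ) ≤ f * (1 + 1 / (f : ℝ)) ^ ((k : ℝ) - f) := by
  have hf' : (0 : ℝ) < f := by exact_mod_cast hf
  have hb : (0 : ℝ) < 1 + 1 / (f : ℝ) := by positivity
  rcases le_total f k with h | h
  · obtain ⟨j, rfl⟩ := Nat.exists_eq_add_of_le h
    have hB := one_add_mul_le_pow (a := 1 / (f : ℝ))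
      (by linarith [show 0 < 1 / (f : ℝ) by positivity]) j
    have : ((f + j : ℕ) : ℝ) - f = (j : ℕ) := by push_cast; ring
    rw [this, Real.rpow_natCast]
    calc ((f + j : ℕ) : ℝ) = f * (1 + j * (1 / f)) := by push_cast; field_simp
      _ ≤ _ := by gcongr
  · obtain ⟨j, rfl⟩ := Nat.exists_eq_add_of_le h
    have : (k : ℝ) - (k + j : ℕ) = -(j : ℕ) := by push_cast; ring
    rw [this, Real.rpow_neg hb.le, Real.rpow_natCast, ← inv_pow]
    set F : ℝ := ((k + j : ℕ) : ℝ) with hF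
    have hinv : (1 + 1 / F)⁻¹ = 1 + -(1 / (F + 1)) := by field_simp; ring
    have h1 : 1 / (F + 1) ≤ 1 := by rw [div_le_one (by positivity)]; linarith
    have hB := one_add_mul_le_pow (a := -(1 / (F + 1))) (by linarith) j
    rw [hinv]
    have h2 : (j : ℝ) * (1 / (F + 1)) ≤ j * (1 / F) := by gcongr; linarith
    calc (k : ℝ) = F * (1 - j * (1 / F)) := by rw [hF]; field_simp; push_cast; ring
      _ ≤ F * (1 + j * -(1 / (F + 1))) := by gcongr; linarith
      _ ≤ _ := by gcongr

theorem prod_natCast_le {V : Type*} [Fintype V] {f : ℕ} (hf : 0 < f) (k : V → ℕ) :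
    ∏ v, (k v : ℝ) ≤ (f : ℝ) ^ (Fintype.card V) *
      (1 + 1 / (f : ℝ)) ^ ((∑ v, (k v : ℝ)) - Fintype.card V * f) := by
  have hb : (0 : ℝ) < 1 + 1 / (f : ℝ) := by positivity
  calc ∏ v, (k v : ℝ) ≤ ∏ v : V, (f : ℝ) * (1 + 1 / (f : ℝ)) ^ ((k v : ℝ) - f) :=
        prod_le_prod (fun _ _ => by positivity) fun v _ => natCast_le_mul_rpow hf (k v)
    _ = _ := by
        rw [prod_mul_distrib, ← Real.rpow_sum_of_pos hb, sum_sub_distrib]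
        simp

theorem eta_rpow {q : ℕ} (hq : 2 ≤ q) (n : ℕ) :
    (eta q : ℝ) ^ ((n : ℝ) / 2) = ((q / 2 : ℕ) : ℝ) ^ n *
      (1 + 1 / ((q / 2 : ℕ) : ℝ)) ^ ((n : ℝ) * q / 2 - n * (q / 2 : ℕ)) := by
  have hf : 0 < q / 2 := by omega
  have hf' : (0 : ℝ) < (q / 2 : ℕ) := by exact_mod_cast hf
  have hsq : ((q / 2 : ℕ) : ℝ) ^ n = (((q / 2 : ℕ) : ℝ) * (q / 2 : ℕ)) ^ ((n : ℝ) / 2) := by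
    rw [← sq, ← Real.rpow_natCast, ← Real.rpow_natCast, ← Real.rpow_mul hf'.le]
    congr 1; push_cast; ring
  rcases Nat.even_or_odd' q with ⟨f, rfl | rfl⟩
  · have h1 : 2 * f / 2 = f := by omega
    have h2 : (2 * f + 1) / 2 = f := by omega
    rw [hsq, eta, h1, h2]
    have : (n : ℝ) * (2 * f : ℕ) / 2 - n * f = 0 := by push_cast; ring
    rw [this, Real.rpow_zero, mul_one]
    push_cast; rfl
  · have h1 : (2 * f + 1) / 2 = f := by omega
    have h2 : (2 * f + 1 + 1) / 2 = f + 1 := by omega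
    rw [h1] at hf hf' hsq
    rw [eta, h1, h2, hsq]
    have : (n : ℝ) * (2 * f + 1 : ℕ) / 2 - n * f = n / 2 := by push_cast; ring
    rw [this, ← Real.mul_rpow (by positivity) (by positivity)]
    congr 1
    push_cast
    field_simp

/-- The number of sets of at most `n / φ` vertices. -/
theorem card_filter_card_mul_le {V : Type*} [Fintype V] [DecidableEq V] {φ : ℝ} (hφ : 1 ≤ φ) :
    (#((univ : Finset (Finset V)).filter fun T => (#T : ℝ) * φ ≤ Fintype.card V) : ℝ) ≤
      Real.exp (Fintype.card V / φ * (1 + Real.log φ)) := by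
  have hφ0 : 0 < φ := by linarith
  set n := Fintype.card V
  have hgen : ∑ T : Finset V, (1 / φ) ^ #T = (1 / φ + 1) ^ n := by
    have := Finset.sum_pow_mul_eq_add_pow (1 / φ) (1 : ℝ) (univ : Finset V)
    simpa using this
  calc (#((univ : Finset (Finset V)).filter fun T => (#T : ℝ) * φ ≤ n) : ℝ)
      = ∑ T ∈ (univ : Finset (Finset V)).filter (fun T => (#T : ℝ) * φ ≤ n), (1 : ℝ) := by simp
    _ ≤ ∑ T ∈ (univ : Finset (Finset V)).filter (fun T => (#T : ℝ) * φ ≤ n),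
          Real.exp (n / φ * Real.log φ) * (1 / φ) ^ #T := by
        refine sum_le_sum fun T hT => ?_
        have hT' := (mem_filter.mp hT).2
        rw [← le_div_iff₀ hφ0] at hT'
        have : (1 / φ) ^ #T = Real.exp (-(#T * Real.log φ)) := by
          rw [Real.exp_neg, Real.exp_nat_mul, Real.exp_log hφ0, one_div, inv_pow]
        rw [this, ← Real.exp_add]
        apply Real.one_le_exp
        nlinarith [Real.log_nonneg hφ]
    _ ≤ ∑ T : Finset V, Real.exp (n / φ * Real.log φ) * (1 / φ) ^ #T :=
        sum_le_sum_of_subset_of_nonneg (filter_subset _ _) fun _ _ _ => by positivity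
    _ = Real.exp (n / φ * Real.log φ) * (1 / φ + 1) ^ n := by rw [← mul_sum, hgen]
    _ ≤ Real.exp (n / φ * Real.log φ) * Real.exp (1 / φ) ^ n := by
        gcongr
        exact Real.add_one_le_exp _
    _ = _ := by
        rw [← Real.exp_nat_mul, ← Real.exp_add]
        congr 1
        ring

end Estimates

section Colorings

theorem card_le_indepNum {V : Type*} [Fintype V] (G : SimpleGraph V) (s : Finset V)
    (hs : ∀ v ∈ s, ∀ w ∈ s, ¬ G.Adj v w) : #s ≤ indepNum G :=
  le_csSup ⟨Fintype.card V, by rintro _ ⟨t, _, rfl⟩; exact card_le_univ t⟩ ⟨s, hs, rfl⟩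

/-- The number of proper colourings whose colour classes lie in prescribed sets `C i`. -/
theorem card_colorings_within_le {V : Type*} [Fintype V] [DecidableEq V] (G : SimpleGraph V)
    [DecidableRel G.Adj] {q : ℕ} (hq : 2 ≤ q) {s ε lam mu : ℝ} (hs : 0 ≤ s)
    (hlam : (2 : ℝ) ^ lam = 1 + 1 / ((q / 2 : ℕ) : ℝ)) (hmu0 : 0 ≤ mu) (hmu : mu ≤ lam)
    (hgam : 1 - 1 / (q : ℝ) ^ 2 ≤ (2 : ℝ) ^ (-(2 * mu)))
    (hα : (indepNum G : ℝ) ≤ (Fintype.card V : ℝ) * (1 - ε) / 2)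
    (C : Fin q → Finset V) (hC : ∀ i, (#(C i) : ℝ) ≤ Fintype.card V / 2 * (1 + s)) :
    (#((univ : Finset (V → Fin q)).filter fun g =>
        (∀ v w, G.Adj v w → g v ≠ g w) ∧ ∀ v, v ∈ C (g v)) : ℝ) ≤
      (eta q : ℝ) ^ ((Fintype.card V : ℝ) / 2) *
        (2 : ℝ) ^ (lam * q / 2 * Fintype.card V * s - mu / 2 * ε * Fintype.card V) := by
  classical
  set n := Fintype.card V
  set i₀ : Fin q := ⟨0, by omega⟩
  set A : V → Finset (Fin q) := fun v => univ.filter fun i => v ∈ C i with hA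
  obtain ⟨m, hm, hcount⟩ := card_list_colorings_le G (card_le_indepNum G) A i₀ (C i₀)
    (fun v hv => by simpa [hA] using hv)
    (fun g => ∀ v ∈ C i₀, ∀ w ∈ C i₀, G.Adj v w → g v ≠ g w) fun _ => Iff.rfl
  rw [Fintype.card_fin] at hcount
  have hsum : ∑ v, (#(A v) : ℝ) = ∑ i, (#(C i) : ℝ) := by
    have := sum_card_bipartiteAbove_eq_sum_card_bipartiteBelow
      (s := (univ : Finset V)) (t := (univ : Finset (Fin q))) fun v i => v ∈ C i
    simp only [bipartiteAbove, bipartiteBelow, filter_univ_mem] at this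
    exact_mod_cast this
  have hsum_le : ∑ i, (#(C i) : ℝ) ≤ #(C i₀) + (q - 1) * (n / 2 * (1 + s)) := by
    rw [← add_sum_erase _ _ (mem_univ i₀)]
    have := sum_le_card_nsmul (univ.erase i₀) (fun i => (#(C i) : ℝ)) _ fun i _ => hC i
    rw [card_erase_of_mem (mem_univ _), card_univ, Fintype.card_fin, nsmul_eq_mul,
      Nat.cast_sub (by omega)] at this
    push_cast at this
    linarith
  have hf : 0 < q / 2 := by omega
  have hq0 : 0 ≤ 1 - 1 / (q : ℝ) ^ 2 := by
    have : (1 : ℝ) ≤ (q : ℝ) ^ 2 := one_le_pow₀ (by exact_mod_cast (by omega : 1 ≤ q))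
    rw [sub_nonneg, div_le_one (by positivity)]
    exact this
  have hgam_pow : (1 - 1 / (q : ℝ) ^ 2) ^ m ≤ (2 : ℝ) ^ (-(2 * mu) * m) := by
    rw [Real.rpow_mul_natCast (by norm_num)]
    exact pow_le_pow_left₀ hq0 hgam m
  have hprod := prod_natCast_le hf fun v => #(A v)
  have hexp : -(2 * mu) * m + lam * (∑ v, (#(A v) : ℝ) - n * (q / 2 : ℕ)) ≤
      lam * ((n : ℝ) * q / 2 - n * (q / 2 : ℕ)) + (lam * q / 2 * n * s - mu / 2 * ε * n) := by
    have hm' : (#(C i₀) : ℝ) ≤ 2 * m + indepNum G := by exact_mod_cast hm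
    have h0 : 0 ≤ mu * (2 * m + n * (1 - ε) / 2 - #(C i₀)) :=
      mul_nonneg hmu0 (by linarith)
    have h1 : 0 ≤ (lam - mu) * (n / 2 * (1 + s) - #(C i₀)) :=
      mul_nonneg (by linarith) (by linarith [hC i₀])
    have h2 : 0 ≤ lam * (#(C i₀) + (q - 1) * (n / 2 * (1 + s)) - ∑ v, (#(A v) : ℝ)) :=
      mul_nonneg (by linarith) (by rw [hsum]; linarith)
    have h3 : 0 ≤ mu * n * s := by positivity
    linarith
  calc _ ≤ (#((Fintype.piFinset A).filter
          fun g => ∀ v ∈ C i₀, ∀ w ∈ C i₀, G.Adj v w → g v ≠ g w) : ℝ) := by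
        refine Nat.cast_le.mpr (card_le_card fun g hg => ?_)
        simp only [mem_filter, mem_univ, true_and, Fintype.mem_piFinset, hA] at hg ⊢
        exact ⟨hg.2, fun v _ w _ => hg.1 v w⟩
    _ ≤ _ := hcount
    _ ≤ (2 : ℝ) ^ (-(2 * mu) * m) * ((((q / 2 : ℕ) : ℝ)) ^ n *
          (1 + 1 / ((q / 2 : ℕ) : ℝ)) ^ ((∑ v, (#(A v) : ℝ)) - n * (q / 2 : ℕ))) :=
        mul_le_mul hgam_pow hprod (prod_nonneg fun _ _ => Nat.cast_nonneg _)
          (Real.rpow_nonneg zero_le_two _)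
    _ = (((q / 2 : ℕ) : ℝ)) ^ n *
          (2 : ℝ) ^ (-(2 * mu) * m + lam * (∑ v, (#(A v) : ℝ) - n * (q / 2 : ℕ))) := by
        rw [← hlam, ← Real.rpow_mul (by norm_num), Real.rpow_add (by norm_num)]
        ring
    _ ≤ (((q / 2 : ℕ) : ℝ)) ^ n * (2 : ℝ) ^ (lam * ((n : ℝ) * q / 2 - n * (q / 2 : ℕ)) +
          (lam * q / 2 * n * s - mu / 2 * ε * n)) := by
        exact mul_le_mul_of_nonneg_left
          (Real.rpow_le_rpow_of_exponent_le one_le_two hexp) (pow_nonneg (Nat.cast_nonneg _) _)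
    _ = _ := by
        rw [eta_rpow hq, ← hlam, ← Real.rpow_mul (by norm_num), Real.rpow_add (by norm_num)]
        ring

/-- Each colour class of a proper colouring lies in one of the containers. -/
theorem numColorings_le_sum {V : Type*} [Fintype V] [DecidableEq V] (G : SimpleGraph V)
    [DecidableRel G.Adj] (q : ℕ) {φ : ℝ} (hφ : 0 < φ) :
    numColorings G q ≤ ∑ T ∈ Fintype.piFinset fun _ : Fin q =>
      (univ : Finset (Finset V)).filter fun T => (#T : ℝ) * φ ≤ Fintype.card V,
      #((univ : Finset (V → Fin q)).filter fun g =>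
        (∀ v w, G.Adj v w → g v ≠ g w) ∧ ∀ v, v ∈ container G φ (T (g v))) := by
  classical
  rw [numColorings, Nat.card_eq_fintype_card, Fintype.card_subtype]
  refine le_trans (card_le_card fun g hg => ?_) card_biUnion_le
  simp only [mem_filter, mem_univ, true_and] at hg
  choose T hT hgT using fun i : Fin q =>
    exists_fingerprint G hφ (univ.filter fun v => g v = i) (by
      intro v hv w hw hvw
      simp only [mem_filter, mem_univ, true_and] at hv hw
      exact hg v w hvw (hv.trans hw.symm))
  simp only [mem_biUnion, Fintype.mem_piFinset, mem_filter, mem_univ, true_and]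
  exact ⟨T, hT, hg, fun v => hgT (g v) (by simp)⟩

/-- The number of fingerprints for the threshold `d * √(log₂ d / d)`. -/
theorem card_fingerprints_le {V : Type*} [Fintype V] [DecidableEq V] {d : ℕ} (hd : 2 ≤ d) :
    (#((univ : Finset (Finset V)).filter
        fun T => (#T : ℝ) * (d * √(Real.logb 2 d / d)) ≤ Fintype.card V) : ℝ) ≤
      (2 : ℝ) ^ (3 * Fintype.card V * √(Real.logb 2 d / d)) := by
  have hd2 : (2 : ℝ) ≤ d := by exact_mod_cast hd
  have hd0 : (0 : ℝ) < d := by linarith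
  have hl1 : 1 ≤ Real.logb 2 d := by
    rw [Real.le_logb_iff_rpow_le (by norm_num) hd0]; simpa using hd2
  have hld : Real.logb 2 d ≤ d := by
    rw [Real.logb_le_iff_le_rpow (by norm_num) hd0, Real.rpow_natCast]
    exact_mod_cast Nat.lt_two_pow_self.le
  set ℓ := Real.logb 2 d with hℓ
  set s := √(ℓ / d) with hs
  have hs0 : 0 < s := Real.sqrt_pos.mpr (by positivity)
  have hss : s * s = ℓ / d := Real.mul_self_sqrt (by positivity)
  have hs1 : s ≤ 1 := Real.sqrt_le_one.mpr ((div_le_one hd0).mpr hld)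
  have hφs : d * s * s = ℓ := by rw [mul_assoc, hss]; field_simp
  have hφ1 : 1 ≤ d * s := by nlinarith
  have hφd : d * s ≤ d := by nlinarith
  have hlog : Real.log d = ℓ * Real.log 2 := by
    rw [hℓ, Real.logb, div_mul_cancel₀ _ (Real.log_pos (by norm_num)).ne']
  refine (card_filter_card_mul_le hφ1).trans ?_
  rw [Real.rpow_def_of_pos (by norm_num), Real.exp_le_exp]
  have h1 : Real.log (d * s) ≤ ℓ * Real.log 2 := by
    rw [← hlog]; exact Real.log_le_log (by linarith) hφd
  have h2 : 1 + Real.log (d * s) ≤ 3 * Real.log 2 * ℓ := by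
    nlinarith [Real.log_two_gt_d9]
  calc Fintype.card V / (d * s) * (1 + Real.log (d * s))
      ≤ Fintype.card V / (d * s) * (3 * Real.log 2 * ℓ) := by gcongr
    _ = _ := by
      rw [← hφs]
      field_simp

end Colorings

theorem colorings_small_indep_set_bound (q : ℕ) (hq : 3 ≤ q) :
    ∃ c₁ c₂ : ℝ, 0 < c₁ ∧ 0 < c₂ ∧
      ∀ (d n : ℕ), 2 ≤ d → d + 1 ≤ n →
        ∀ ε : ℝ, 0 ≤ ε → ε ≤ 1 →
          ∀ (G : SimpleGraph (Fin n)) [DecidableRel G.Adj],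
            G.IsRegularOfDegree d →
            (indepNum G : ℝ) ≤ (n : ℝ) * (1 - ε) / 2 →
            (numColorings G q : ℝ) ≤
              (eta q : ℝ) ^ ((n : ℝ) / 2) *
                (2 : ℝ) ^ (c₁ * n * Real.sqrt (Real.logb 2 d / d) - c₂ * ε * n) := by
  have hf : (0 : ℝ) < (q / 2 : ℕ) := by exact_mod_cast (by omega : 0 < q / 2)
  have hq3 : (3 : ℝ) ≤ q := by exact_mod_cast hq
  set lam := Real.logb 2 (1 + 1 / ((q / 2 : ℕ) : ℝ)) with hlam
  have hlam0 : 0 < lam :=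
    Real.logb_pos (by norm_num) (by linarith [show 0 < 1 / ((q / 2 : ℕ) : ℝ) by positivity])
  have hlam2 : (2 : ℝ) ^ lam = 1 + 1 / ((q / 2 : ℕ) : ℝ) :=
    Real.rpow_logb (by norm_num) (by norm_num) (by positivity)
  have hg0 : 0 < 1 - 1 / (q : ℝ) ^ 2 := by
    rw [sub_pos, div_lt_one (by positivity)]
    nlinarith
  have hg1 : Real.logb 2 (1 - 1 / (q : ℝ) ^ 2) < 0 :=
    Real.logb_neg (by norm_num) hg0 (by linarith [show 0 < 1 / (q : ℝ) ^ 2 by positivity])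
  set mu := min lam (-Real.logb 2 (1 - 1 / (q : ℝ) ^ 2) / 2) with hmu
  have hmu0 : 0 < mu := lt_min hlam0 (by linarith)
  have hgam : 1 - 1 / (q : ℝ) ^ 2 ≤ (2 : ℝ) ^ (-(2 * mu)) := by
    rw [← Real.logb_le_iff_le_rpow (by norm_num) hg0]
    linarith [min_le_right lam (-Real.logb 2 (1 - 1 / (q : ℝ) ^ 2) / 2)]
  refine ⟨3 * q + lam * q / 2, mu / 2, by positivity, by positivity, ?_⟩
  intro d n hd _ ε _ _ G _ hG hα
  have hd0 : (0 : ℝ) < d := by exact_mod_cast (by omega : 0 < d)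
  have hl0 : 0 < Real.logb 2 d := Real.logb_pos (by norm_num) (by exact_mod_cast hd)
  have hld : Real.logb 2 d ≤ d := by
    rw [Real.logb_le_iff_le_rpow (by norm_num) hd0, Real.rpow_natCast]
    exact_mod_cast Nat.lt_two_pow_self.le
  have hcount := card_fingerprints_le (V := Fin n) hd
  set s := √(Real.logb 2 d / d) with hs
  have hs0 : 0 < s := Real.sqrt_pos.mpr (by positivity)
  have hs1 : s ≤ 1 := Real.sqrt_le_one.mpr ((div_le_one hd0).mpr hld)
  have hφd : d * s ≤ d := by nlinarith
  have hC : ∀ T : Finset (Fin n), (#(container G (d * s) T) : ℝ) ≤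
      Fintype.card (Fin n) / 2 * (1 + s) := fun T => by
    have := card_container_le G (by omega) hG (by positivity) hφd T
    rwa [mul_div_cancel_left₀ _ hd0.ne'] at this
  set 𝒯 := (univ : Finset (Finset (Fin n))).filter
    fun T => (#T : ℝ) * (d * s) ≤ Fintype.card (Fin n) with h𝒯
  set B := (eta q : ℝ) ^ ((n : ℝ) / 2) *
    (2 : ℝ) ^ (lam * q / 2 * n * s - mu / 2 * ε * n) with hB
  calc (numColorings G q : ℝ)
      ≤ ∑ T ∈ Fintype.piFinset fun _ : Fin q => 𝒯,
          (#((univ : Finset (Fin n → Fin q)).filter fun g =>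
            (∀ v w, G.Adj v w → g v ≠ g w) ∧ ∀ v, v ∈ container G (d * s) (T (g v))) : ℝ) := by
        exact_mod_cast numColorings_le_sum G q (φ := d * s) (by positivity)
    _ ≤ ∑ T ∈ Fintype.piFinset fun _ : Fin q => 𝒯, B := by
        refine sum_le_sum fun T _ => ?_
        have := card_colorings_within_le G (by omega) hs0.le hlam2 hmu0.le (min_le_left _ _) hgam
          (by rwa [Fintype.card_fin]) (fun i => container G (d * s) (T i)) fun i => hC (T i)
        rw [Fintype.card_fin] at this
        refine le_of_eq_of_le ?_ this
        congr!
    _ = (#𝒯 : ℝ) ^ q * B := by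
        rw [sum_const, nsmul_eq_mul, Fintype.card_piFinset]
        simp
    _ ≤ ((2 : ℝ) ^ (3 * n * s)) ^ q * B := by
        rw [Fintype.card_fin] at hcount
        gcongr
    _ = _ := by
        rw [hB, ← Real.rpow_mul_natCast (by norm_num), mul_left_comm,
          ← Real.rpow_add (by norm_num)]
        congr 2
        ring
end
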